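/- Every nonempty packed word w can be written uniquely as w = v₁ * v₂ * ... * v_n, where each v_i is a nonempty irreducible packed word. Consequently the set of packed words under shifted concatenation is a free monoid on the set of irreducible packed words. -/

import Mathlib

/-- Words over the alphabet `X = {x_i : i ≥ 0}`, identified with lists of natural numbers. -/
abbrev Word : Type := List ℕ

/-- `IAlph w` is the set of indices of letters occurring in `w`. -/
def IAlph (w : Word) : Finset ℕ := w.toFinset

/-- `wsup w` is the supremum of `IAlph w` (0 for the empty word). -/
def wsup (w : Word) : ℕ := w.foldr max 0

/-- The substitution `S_φ` replaces each letter `x_i` by `x_{φ i}`. -/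
def subst (φ : ℕ → ℕ) (w : Word) : Word := w.map φ

/-- The packing substitution `φ_w`: it sends the `m`-th smallest nonzero letter of `w` to `m`,
and `0` to `0`. -/
def packMap (w : Word) (i : ℕ) : ℕ := (((IAlph w).erase 0).filter (fun j => j ≤ i)).card

/-- `pack w = S_{φ_w} w`. -/
def pack (w : Word) : Word := subst (packMap w) w

/-- A word is packed if `pack w = w`. -/
def IsPacked (w : Word) : Prop := pack w = w

/-- `T_t`: shift every nonzero letter by `t`, fixing `x_0`. -/
def shiftW (t : ℕ) (w : Word) : Word := subst (fun n => if n = 0 then 0 else n + t) w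

/-- Shifted concatenation `u * v = u · T_{sup u}(v)`. -/
def sc (u v : Word) : Word := u ++ shiftW (wsup u) v

/-- `w[I]`: the subword of `w` formed by the letters at the (1-indexed) positions in `I`,
taken in increasing order of position. -/
def subword (w : Word) (I : Finset ℕ) : Word :=
  ((List.range w.length).filter (fun j => decide (j + 1 ∈ I))).map (fun j => w.getD j 0)

/-- Quotient by a set of indices: `w / A = S_{φ_A} w` where `φ_A i = 0` if `i ∈ A`, else `i`. -/
def quotSet (w : Word) (A : Finset ℕ) : Word := subst (fun i => if i ∈ A then 0 else i) w

/-- Quotient by a word: `w / u = w / IAlph u`. -/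
def quotWord (w u : Word) : Word := quotSet w (IAlph u)

/-- A packed word is irreducible if it cannot be written as `u * v` with `u, v`
both nonempty packed words. -/
def IrredPacked (w : Word) : Prop :=
  IsPacked w ∧
    ¬∃ u v : Word, u ≠ [] ∧ v ≠ [] ∧ IsPacked u ∧ IsPacked v ∧ w = sc u v

theorem isPacked_iff (w : Word) :
    IsPacked w ↔ ∀ i ∈ w, ∀ j, 0 < j → j ≤ i → j ∈ w := by
  have key : ∀ i, packMap w i = i ↔ ∀ j, 0 < j → j ≤ i → j ∈ w := by
    intro i
    have hsub : ((IAlph w).erase 0).filter (fun j => j ≤ i) ⊆ Finset.Icc 1 i := by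
      intro j hj
      simp only [Finset.mem_filter, Finset.mem_erase, Finset.mem_Icc] at hj ⊢
      omega
    constructor
    · intro h j hj hji
      have heq := Finset.eq_of_subset_of_card_le hsub (by
        rw [Nat.card_Icc]
        unfold packMap at h
        omega)
      have hmem : j ∈ Finset.Icc 1 i := Finset.mem_Icc.2 ⟨hj, hji⟩
      rw [← heq] at hmem
      simp only [Finset.mem_filter, Finset.mem_erase, IAlph, List.mem_toFinset] at hmem
      exact hmem.1.2
    · intro h
      have heq : ((IAlph w).erase 0).filter (fun j => j ≤ i) = Finset.Icc 1 i := by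
        refine Finset.Subset.antisymm hsub fun j hj => ?_
        rw [Finset.mem_Icc] at hj
        simp only [Finset.mem_filter, Finset.mem_erase, IAlph, List.mem_toFinset]
        exact ⟨⟨by omega, h j hj.1 hj.2⟩, hj.2⟩
      rw [packMap, heq, Nat.card_Icc]
      omega
  have hmap : IsPacked w ↔ ∀ i ∈ w, packMap w i = i := by
    unfold IsPacked pack subst
    simpa only [List.map_id, id] using List.map_inj_left (l := w) (f := packMap w) (g := id)
  simp only [hmap, key]

theorem le_wsup {w : Word} {i : ℕ} (h : i ∈ w) : i ≤ wsup w := by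
  induction w with
  | nil => simp at h
  | cons a w ih =>
    simp only [wsup, List.foldr_cons] at ih ⊢
    rcases List.mem_cons.1 h with rfl | h
    · exact le_max_left _ _
    · exact le_max_of_le_right (ih h)

theorem shiftW_append (t : ℕ) (u v : Word) :
    shiftW t (u ++ v) = shiftW t u ++ shiftW t v :=
  List.map_append

theorem shiftW_zero (w : Word) : shiftW 0 w = w := by
  unfold shiftW subst
  refine (List.map_congr_left fun i _ => ?_).trans (List.map_id w)
  dsimp only [id]
  split <;> omega

theorem shiftW_shiftW (s t : ℕ) (w : Word) : shiftW s (shiftW t w) = shiftW (s + t) w := by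
  unfold shiftW subst
  rw [List.map_map]
  refine List.map_congr_left fun i _ => ?_
  simp only [Function.comp]
  split_ifs <;> omega

theorem shiftW_injective (t : ℕ) : Function.Injective (shiftW t) := by
  refine List.map_injective_iff.2 fun a b h => ?_
  split_ifs at h <;> omega

theorem add_mem_shiftW {t i : ℕ} {w : Word} (hi : 0 < i) : i + t ∈ shiftW t w ↔ i ∈ w := by
  simp only [shiftW, subst, List.mem_map]
  constructor
  · rintro ⟨a, ha, h⟩
    split_ifs at h
    · omega
    · obtain rfl : a = i := by omega
      exact ha
  · exact fun h => ⟨i, h, by rw [if_neg hi.ne']⟩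

theorem wsup_append (u v : Word) : wsup (u ++ v) = max (wsup u) (wsup v) := by
  induction u with
  | nil => simp [wsup]
  | cons a u ih =>
    simp only [wsup, List.cons_append, List.foldr_cons] at ih ⊢
    rw [ih, max_assoc]

theorem max_wsup_shiftW (t : ℕ) (w : Word) : max t (wsup (shiftW t w)) = t + wsup w := by
  induction w with
  | nil => simp [wsup, shiftW, subst]
  | cons a w ih =>
    simp only [wsup, shiftW, subst, List.map_cons, List.foldr_cons] at ih ⊢
    split_ifs <;> omega

theorem wsup_sc (u v : Word) : wsup (sc u v) = wsup u + wsup v := by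
  rw [sc, wsup_append, max_wsup_shiftW]

theorem nil_sc (w : Word) : sc [] w = w := shiftW_zero w

theorem sc_nil (w : Word) : sc w [] = w := List.append_nil w

theorem sc_assoc (u v w : Word) : sc (sc u v) w = sc u (sc v w) := by
  conv_lhs => rw [sc, wsup_sc]
  simp only [sc, shiftW_append, shiftW_shiftW, List.append_assoc]

theorem length_sc (u v : Word) : (sc u v).length = u.length + v.length := by
  simp [sc, shiftW, subst]

theorem foldr_sc_append (L M : List Word) :
    (L ++ M).foldr sc [] = sc (L.foldr sc []) (M.foldr sc []) := by
  induction L with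
  | nil => exact (nil_sc _).symm
  | cons a L ih => rw [List.cons_append, List.foldr_cons, List.foldr_cons, ih, sc_assoc]

theorem IsPacked.of_sc {u v : Word} (h : IsPacked (sc u v)) : IsPacked v := by
  rw [isPacked_iff] at h ⊢
  intro i hi j hj hji
  have hmem : j + wsup u ∈ sc u v :=
    h (i + wsup u) (List.mem_append_right _ ((add_mem_shiftW (by omega)).2 hi)) _
      (by omega) (by omega)
  rcases List.mem_append.1 hmem with hu | hv
  · have := le_wsup hu
    omega
  · exact (add_mem_shiftW hj).1 hv

theorem exists_irredPacked_factorization (w : Word) (hw : IsPacked w) :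
    ∃ L : List Word, (∀ v ∈ L, v ≠ [] ∧ IrredPacked v) ∧ w = L.foldr sc [] := by
  induction hn : w.length using Nat.strong_induction_on generalizing w with
  | _ n ih =>
    by_cases hnil : w = []
    · exact ⟨[], by simp, hnil⟩
    by_cases hirr : IrredPacked w
    · exact ⟨[w], by simpa using ⟨hnil, hirr⟩, (sc_nil w).symm⟩
    obtain ⟨u, v, hu, hv, hpu, hpv, rfl⟩ :
        ∃ u v : Word, u ≠ [] ∧ v ≠ [] ∧ IsPacked u ∧ IsPacked v ∧ w = sc u v := by
      by_contra h
      exact hirr ⟨hw, h⟩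
    rw [length_sc] at hn
    have hlu := List.length_pos_iff.2 hu
    have hlv := List.length_pos_iff.2 hv
    obtain ⟨L, hL, hLu⟩ := ih u.length (by omega) u hpu rfl
    obtain ⟨M, hM, hMv⟩ := ih v.length (by omega) v hpv rfl
    refine ⟨L ++ M, fun x hx => ?_, by rw [foldr_sc_append, ← hLu, ← hMv]⟩
    exact (List.mem_append.1 hx).elim (hL x) (hM x)

/-- If an irreducible packed word `x` equals `u ++ y` with `u` packed and nonempty, and `y` is a
prefix of a word shifted by `wsup u`, then `y` is empty. -/
theorem IrredPacked.eq_nil_of_eq_append {u v x z y : Word} (hx : IrredPacked x)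
    (hu : IsPacked u) (hne : u ≠ []) (hxu : x = u ++ y)
    (hy : shiftW (wsup u) v = y ++ z) : y = [] := by
  obtain ⟨p, q, -, rfl, -⟩ := List.map_eq_append_iff.1 hy
  by_contra hp
  have hsc : x = sc u p := hxu
  exact hx.2 ⟨u, p, hne, by rintro rfl; exact hp rfl, hu, (hsc ▸ hx.1).of_sc, hsc⟩

theorem IrredPacked.sc_inj {u u' v v' : Word} (hu : IrredPacked u) (hu' : IrredPacked u')
    (hne : u ≠ []) (hne' : u' ≠ []) (h : sc u v = sc u' v') : u = u' ∧ v = v' := by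
  have huu : u = u' := by
    rcases List.append_eq_append_iff.1 h with ⟨y, h₁, h₂⟩ | ⟨y, h₁, h₂⟩
    · rw [h₁, hu'.eq_nil_of_eq_append hu.1 hne h₁ h₂, List.append_nil]
    · rw [h₁, hu.eq_nil_of_eq_append hu'.1 hne' h₁ h₂, List.append_nil]
  subst huu
  exact ⟨rfl, shiftW_injective _ (List.append_cancel_left h)⟩

theorem irredPacked_factorization_unique {L M : List Word}
    (hL : ∀ v ∈ L, v ≠ [] ∧ IrredPacked v) (hM : ∀ v ∈ M, v ≠ [] ∧ IrredPacked v)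
    (h : L.foldr sc [] = M.foldr sc []) : L = M := by
  have sc_ne_nil : ∀ {u v : Word}, u ≠ [] → sc u v ≠ [] :=
    fun hu => List.append_ne_nil_of_left_ne_nil hu _
  induction L generalizing M with
  | nil =>
    cases M with
    | nil => rfl
    | cons b M => exact absurd h.symm (sc_ne_nil (hM b List.mem_cons_self).1)
  | cons a L ih =>
    cases M with
    | nil => exact absurd h (sc_ne_nil (hL a List.mem_cons_self).1)
    | cons b M =>
      obtain ⟨hane, ha⟩ := hL a List.mem_cons_self
      obtain ⟨hbne, hb⟩ := hM b List.mem_cons_self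
      obtain ⟨rfl, htail⟩ := ha.sc_inj hb hane hbne h
      rw [ih (fun v hv => hL v (List.mem_cons_of_mem _ hv))
        (fun v hv => hM v (List.mem_cons_of_mem _ hv)) htail]

/-- Every nonempty packed word factors uniquely as a shifted concatenation
`v₁ * v₂ * ⋯ * v_n` of nonempty irreducible packed words; consequently every packed word
(including the empty one) has a unique such factorization, i.e. the monoid of packed words
under shifted concatenation is free on the irreducible packed words. -/
theorem packed_unique_factorization :
    (∀ w : Word, IsPacked w → w ≠ [] →
      ∃! L : List Word, L ≠ [] ∧ (∀ v ∈ L, v ≠ [] ∧ IrredPacked v) ∧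
        w = L.foldr sc []) ∧
    (∀ w : Word, IsPacked w →
      ∃! L : List Word, (∀ v ∈ L, v ≠ [] ∧ IrredPacked v) ∧ w = L.foldr sc []) := by
  refine ⟨fun w hw hne => ?_, fun w hw => ?_⟩ <;>
    obtain ⟨L, hL, hLw⟩ := exists_irredPacked_factorization w hw
  · refine ⟨L, ⟨?_, hL, hLw⟩, fun M hM =>
      irredPacked_factorization_unique hM.2.1 hL (hM.2.2.symm.trans hLw)⟩
    rintro rfl
    exact hne hLw
  · exact ⟨L, ⟨hL, hLw⟩, fun M hM =>
      irredPacked_factorization_unique hM.1 hL (hM.2.symm.trans hLw)⟩
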